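/- arXiv:2110.07295 — 5 statements merged into one kernel-verified Lean document; each statement's English description precedes it below -/
import Mathlib

section
/- Let X be a complex Banach space and (S_t)_{t≥0} a strongly continuous semigroup on X with generator H, and suppose there is a constant K > 0 such that ‖S_t‖ ≤ e^{Kt} for all t ≥ 0. Fix a real number λ < −K. Then: (a) for every φ ∈ X the Bochner integral R_λ φ := −∫₀^∞ e^{λ s} S_s φ ds converges and satisfies ‖R_λ φ‖ ≤ (−λ − K)^{−1} ‖φ‖; (b) for every φ ∈ X, R_λ φ ∈ dom(H) and λ·R_λ φ − H(R_λ φ) = φ; (c) λ·Id − H is injective on dom(H). Consequently λ·Id − H : dom(H) → X is a bijection whose inverse is the bounded operator R_λ, of norm at most (−λ − K)^{−1}. -/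
open Filter Topology MeasureTheory

/-- `IsGenVal S ψ χ` says that `ψ` is in the domain of the generator `H` of the
semigroup `(S_t)` and `H ψ = χ`, i.e. `χ = lim_{t → 0⁺} t⁻¹ (ψ - S_t ψ)`. -/
def IsGenVal {X : Type*} [NormedAddCommGroup X] [NormedSpace ℂ X]
    (S : ℝ → X →L[ℂ] X) (ψ χ : X) : Prop :=
  Tendsto (fun t : ℝ => t⁻¹ • (ψ - S t ψ)) (𝓝[>] 0) (𝓝 χ)

namespace IsGenVal

variable {X : Type*} [NormedAddCommGroup X] [NormedSpace ℂ X] {S : ℝ → X →L[ℂ] X}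

theorem iff_hasDerivWithinAt (hS0 : S 0 = 1) {ψ χ : X} :
    IsGenVal S ψ χ ↔ HasDerivWithinAt (fun t => S t ψ) (-χ) (Set.Ici 0) 0 := by
  rw [← hasDerivWithinAt_Ioi_iff_Ici, hasDerivWithinAt_iff_tendsto_slope' Set.self_notMem_Ioi,
    IsGenVal, ← tendsto_neg_iff]
  refine Eq.to_iff (congrArg (fun f => Tendsto f (𝓝[>] 0) (𝓝 (-χ))) (funext fun t => ?_))
  simp [slope, hS0, ← smul_neg]

theorem sub {ψ₁ ψ₂ χ₁ χ₂ : X} (h₁ : IsGenVal S ψ₁ χ₁) (h₂ : IsGenVal S ψ₂ χ₂) :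
    IsGenVal S (ψ₁ - ψ₂) (χ₁ - χ₂) := by
  refine (Tendsto.sub h₁ h₂).congr fun t => ?_
  rw [map_sub, ← smul_sub]
  congr 1
  abel

/-- The orbit of a vector in the domain of the generator is right differentiable. -/
theorem hasDerivWithinAt
    (hSsemigroup : ∀ s t : ℝ, 0 ≤ s → 0 ≤ t → S (t + s) = (S t).comp (S s))
    {ψ χ : X} (h : IsGenVal S ψ χ) {t : ℝ} (ht : 0 ≤ t) :
    HasDerivWithinAt (fun s => S s ψ) (-S t χ) (Set.Ici t) t := by
  rw [← hasDerivWithinAt_Ioi_iff_Ici, hasDerivWithinAt_iff_tendsto_slope' Set.self_notMem_Ioi]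
  have hshift : Tendsto (fun s => s - t) (𝓝[>] t) (𝓝[>] 0) := by
    refine tendsto_nhdsWithin_iff.2 ⟨?_, ?_⟩
    · have : Tendsto (fun s : ℝ => s - t) (𝓝 t) (𝓝 (t - t)) :=
        (continuous_id.sub continuous_const).tendsto t
      rw [sub_self] at this
      exact this.mono_left nhdsWithin_le_nhds
    · filter_upwards [self_mem_nhdsWithin] with s hs using Set.mem_Ioi.2 (sub_pos.2 (Set.mem_Ioi.1 hs))
  have hlim := (((S t).continuous.tendsto χ).comp (Tendsto.comp h hshift)).neg
  refine hlim.congr' ?_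
  filter_upwards [self_mem_nhdsWithin] with s hs
  have hs' : S s = (S t).comp (S (s - t)) := by
    rw [← hSsemigroup (s - t) t (sub_nonneg.2 (le_of_lt hs)) ht, add_sub_cancel]
  simp [slope, hs', map_sub, ContinuousLinearMap.map_smul_of_tower, ← smul_neg]

/-- A real eigenvalue of the generator is at least `-K`. -/
theorem eq_zero_of_eigenvalue (hS0 : S 0 = 1)
    (hSsemigroup : ∀ s t : ℝ, 0 ≤ s → 0 ≤ t → S (t + s) = (S t).comp (S s))
    (hScont : ∀ ψ : X, ContinuousOn (fun t => S t ψ) (Set.Ici 0))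
    {K : ℝ} (hSnorm : ∀ t : ℝ, 0 ≤ t → ‖S t‖ ≤ Real.exp (K * t))
    {lam : ℝ} (hlam : lam < -K) {ψ : X} (h : IsGenVal S ψ (lam • ψ)) : ψ = 0 := by
  have hcont : ContinuousOn (fun t => Real.exp (lam * t) • S t ψ) (Set.Icc 0 1) :=
    (by fun_prop : Continuous fun t : ℝ => Real.exp (lam * t)).continuousOn.smul
      ((hScont ψ).mono Set.Icc_subset_Ici_self)
  have hderiv : ∀ t ∈ Set.Ico (0 : ℝ) 1,
      HasDerivWithinAt (fun t => Real.exp (lam * t) • S t ψ) 0 (Set.Ici t) t := by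
    intro t ht
    have hexp : HasDerivAt (fun t : ℝ => Real.exp (lam * t)) (Real.exp (lam * t) * lam) t := by
      simpa using ((hasDerivAt_id t).const_mul lam).exp
    refine (hexp.hasDerivWithinAt.smul (h.hasDerivWithinAt hSsemigroup ht.1)).congr_deriv ?_
    simp [ContinuousLinearMap.map_smul_of_tower, mul_smul]
  have hconst := constant_of_has_deriv_right_zero hcont hderiv 1 (by simp)
  simp only [mul_one, mul_zero, Real.exp_zero, hS0, one_smul,
    one_apply_eq_self] at hconst
  by_contra hψ
  have hpos : 0 < ‖ψ‖ := norm_pos_iff.2 hψ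
  have hle : ‖ψ‖ ≤ Real.exp (lam + K) * ‖ψ‖ := by
    calc ‖ψ‖ = Real.exp lam * ‖S 1 ψ‖ := by
          rw [← Real.abs_exp lam, ← Real.norm_eq_abs, ← norm_smul, hconst]
      _ ≤ Real.exp lam * (Real.exp K * ‖ψ‖) := by
          gcongr
          exact (S 1).le_of_opNorm_le (by simpa using hSnorm 1 zero_le_one) ψ
      _ = Real.exp (lam + K) * ‖ψ‖ := by rw [Real.exp_add, mul_assoc]
  have hlt : Real.exp (lam + K) < 1 := Real.exp_lt_one_iff.2 (by linarith)
  nlinarith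

end IsGenVal

section LaplaceTransform

variable {X : Type*} [NormedAddCommGroup X] [NormedSpace ℂ X] {S : ℝ → X →L[ℂ] X}

theorem norm_exp_smul_semigroup_le {K : ℝ} (hSnorm : ∀ t : ℝ, 0 ≤ t → ‖S t‖ ≤ Real.exp (K * t))
    (lam : ℝ) (φ : X) {s : ℝ} (hs : 0 ≤ s) :
    ‖Real.exp (lam * s) • S s φ‖ ≤ Real.exp ((lam + K) * s) * ‖φ‖ := by
  rw [norm_smul, Real.norm_eq_abs, Real.abs_exp, add_mul, Real.exp_add, mul_assoc]
  gcongr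
  exact (S s).le_of_opNorm_le (hSnorm s hs) φ

theorem continuousOn_exp_smul_semigroup
    (hScont : ∀ ψ : X, ContinuousOn (fun t => S t ψ) (Set.Ici 0)) (lam : ℝ) (φ : X) :
    ContinuousOn (fun s => Real.exp (lam * s) • S s φ) (Set.Ici 0) :=
  (by fun_prop : Continuous fun t : ℝ => Real.exp (lam * t)).continuousOn.smul (hScont φ)

theorem integrableOn_exp_smul_semigroup
    (hScont : ∀ ψ : X, ContinuousOn (fun t => S t ψ) (Set.Ici 0))
    {K : ℝ} (hSnorm : ∀ t : ℝ, 0 ≤ t → ‖S t‖ ≤ Real.exp (K * t))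
    {lam : ℝ} (hlam : lam < -K) (φ : X) :
    IntegrableOn (fun s : ℝ => Real.exp (lam * s) • S s φ) (Set.Ioi 0) := by
  refine Integrable.mono' ((integrableOn_exp_mul_Ioi (a := lam + K) (by linarith) 0).mul_const ‖φ‖)
    (((continuousOn_exp_smul_semigroup hScont lam φ).mono
      Set.Ioi_subset_Ici_self).aestronglyMeasurable measurableSet_Ioi) ?_
  filter_upwards [ae_restrict_mem measurableSet_Ioi] with s hs
  exact norm_exp_smul_semigroup_le hSnorm lam φ (le_of_lt hs)

theorem norm_integral_exp_smul_semigroup_le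
    {K : ℝ} (hSnorm : ∀ t : ℝ, 0 ≤ t → ‖S t‖ ≤ Real.exp (K * t))
    {lam : ℝ} (hlam : lam < -K) (φ : X) :
    ‖∫ s in Set.Ioi (0 : ℝ), Real.exp (lam * s) • S s φ‖ ≤ (-lam - K)⁻¹ * ‖φ‖ := by
  have hneg : lam + K < 0 := by linarith
  refine (norm_integral_le_of_norm_le ((integrableOn_exp_mul_Ioi hneg 0).mul_const ‖φ‖)
    ?_).trans_eq ?_
  · filter_upwards [ae_restrict_mem measurableSet_Ioi] with s hs
    exact norm_exp_smul_semigroup_le hSnorm lam φ (le_of_lt hs)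
  · rw [integral_mul_const, integral_exp_mul_Ioi hneg, mul_zero, Real.exp_zero,
      show -lam - K = -(lam + K) by ring, inv_neg, neg_div, one_div]

variable [CompleteSpace X]

theorem semigroup_integral_exp_smul
    (hSsemigroup : ∀ s t : ℝ, 0 ≤ s → 0 ≤ t → S (t + s) = (S t).comp (S s))
    {lam : ℝ} {φ : X}
    (hint : IntegrableOn (fun s : ℝ => Real.exp (lam * s) • S s φ) (Set.Ioi 0))
    {t : ℝ} (ht : 0 ≤ t) :
    S t (∫ s in Set.Ioi (0 : ℝ), Real.exp (lam * s) • S s φ) =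
      Real.exp (-lam * t) • ((∫ s in Set.Ioi (0 : ℝ), Real.exp (lam * s) • S s φ) -
        ∫ s in (0 : ℝ)..t, Real.exp (lam * s) • S s φ) := by
  have hshift : ∫ s in Set.Ioi (0 : ℝ), Real.exp (lam * (s + t)) • S (s + t) φ =
      ∫ s in Set.Ioi t, Real.exp (lam * s) • S s φ := by
    have := (measurePreserving_add_right volume t).setIntegral_preimage_emb
      (measurableEmbedding_addRight t) (fun s => Real.exp (lam * s) • S s φ) (Set.Ioi t)
    simpa using this
  rw [← intervalIntegral.integral_Ioi_sub_Ioi hint ht, sub_sub_cancel, ← hshift,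
    ← integral_smul, ← (S t).integral_comp_comm hint]
  refine setIntegral_congr_fun measurableSet_Ioi fun s hs => ?_
  simp only [ContinuousLinearMap.map_smul_of_tower]
  rw [smul_smul, ← Real.exp_add, add_comm s t, hSsemigroup s t (le_of_lt hs) ht]
  simp only [ContinuousLinearMap.comp_apply]
  congr 2
  ring

/-- The Laplace transform of an orbit lies in the domain of the generator. -/
theorem isGenVal_integral_exp_smul (hS0 : S 0 = 1)
    (hSsemigroup : ∀ s t : ℝ, 0 ≤ s → 0 ≤ t → S (t + s) = (S t).comp (S s))
    (hScont : ∀ ψ : X, ContinuousOn (fun t => S t ψ) (Set.Ici 0)) {lam : ℝ} {φ : X}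
    (hint : IntegrableOn (fun s : ℝ => Real.exp (lam * s) • S s φ) (Set.Ioi 0)) :
    IsGenVal S (-∫ s in Set.Ioi (0 : ℝ), Real.exp (lam * s) • S s φ)
      (lam • (-∫ s in Set.Ioi (0 : ℝ), Real.exp (lam * s) • S s φ) - φ) := by
  rw [IsGenVal.iff_hasDerivWithinAt hS0]
  set I := ∫ s in Set.Ioi (0 : ℝ), Real.exp (lam * s) • S s φ with hI
  have hcont := continuousOn_exp_smul_semigroup hScont lam φ
  have hprim : HasDerivWithinAt (fun t => ∫ s in (0 : ℝ)..t, Real.exp (lam * s) • S s φ)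
      φ (Set.Ici 0) 0 := by
    have := intervalIntegral.integral_hasDerivWithinAt_right (a := 0) (b := 0)
      (s := Set.Ici 0) (t := Set.Ioi 0) (f := fun s => Real.exp (lam * s) • S s φ) (by simp)
      ((hcont.mono Set.Ioi_subset_Ici_self).stronglyMeasurableAtFilter_nhdsWithin
        measurableSet_Ioi 0)
      ((hcont 0 Set.self_mem_Ici).mono Set.Ioi_subset_Ici_self)
    simpa [hS0] using this
  have hexp : HasDerivAt (fun t : ℝ => Real.exp (-lam * t)) (-lam) 0 := by
    simpa using ((hasDerivAt_id (0 : ℝ)).const_mul (-lam)).exp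
  have hderiv := (hexp.hasDerivWithinAt.smul (hprim.const_sub I)).neg
  refine (hderiv.congr_of_mem (fun t ht => ?_) Set.self_mem_Ici).congr_deriv ?_
  · have := semigroup_integral_exp_smul hSsemigroup hint ht
    rw [← hI] at this
    simp [this]
  · simp
    abel

end LaplaceTransform

/-- For a strongly continuous semigroup `(S_t)_{t ≥ 0}` with generator `H` and
`‖S_t‖ ≤ e^{K t}` (`K > 0`), and `λ < -K`:
(a) the Bochner integral `R_λ φ = -∫₀^∞ e^{λ s} S_s φ ds` converges with
`‖R_λ φ‖ ≤ (-λ-K)⁻¹ ‖φ‖`; (b) `R_λ φ ∈ dom H` with `λ R_λ φ - H (R_λ φ) = φ`;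
(c) `λ - H` is injective on `dom H`. Hence `λ - H` is a bijection `dom H → X`
with bounded inverse `R_λ`. -/
theorem resolvent_of_semigroup
    {X : Type*} [NormedAddCommGroup X] [NormedSpace ℂ X] [CompleteSpace X]
    (S : ℝ → X →L[ℂ] X)
    (hS0 : S 0 = 1)
    (hSsemigroup : ∀ s t : ℝ, 0 ≤ s → 0 ≤ t → S (t + s) = (S t).comp (S s))
    (hScont : ∀ ψ : X, ContinuousOn (fun t => S t ψ) (Set.Ici 0))
    (K : ℝ) (hK : 0 < K)
    (hSnorm : ∀ t : ℝ, 0 ≤ t → ‖S t‖ ≤ Real.exp (K * t))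
    (lam : ℝ) (hlam : lam < -K) :
    -- (a) convergence of the defining integral and the norm bound
    (∀ φ : X, MeasureTheory.IntegrableOn (fun s : ℝ => Real.exp (lam * s) • S s φ)
        (Set.Ioi 0)) ∧
    (∀ φ : X, ‖-∫ s in Set.Ioi (0:ℝ), Real.exp (lam * s) • S s φ‖ ≤ (-lam - K)⁻¹ * ‖φ‖) ∧
    -- (b) `R_λ φ ∈ dom H` and `λ • R_λ φ - H (R_λ φ) = φ`
    (∀ φ : X, ∃ χ : X,
        IsGenVal S (-∫ s in Set.Ioi (0:ℝ), Real.exp (lam * s) • S s φ) χ ∧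
        lam • (-∫ s in Set.Ioi (0:ℝ), Real.exp (lam * s) • S s φ) - χ = φ) ∧
    -- (c) `λ • Id - H` is injective on `dom H`
    (∀ ψ₁ ψ₂ χ₁ χ₂ : X, IsGenVal S ψ₁ χ₁ → IsGenVal S ψ₂ χ₂ →
        lam • ψ₁ - χ₁ = lam • ψ₂ - χ₂ → ψ₁ = ψ₂) := by
  have hint := integrableOn_exp_smul_semigroup hScont hSnorm hlam
  refine ⟨hint, fun φ => ?_, fun φ => ⟨_, isGenVal_integral_exp_smul hS0 hSsemigroup hScont
    (hint φ), sub_sub_cancel _ _⟩, fun ψ₁ ψ₂ χ₁ χ₂ h₁ h₂ heq => ?_⟩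
  · rw [norm_neg]
    exact norm_integral_exp_smul_semigroup_le hSnorm hlam φ
  · have hχ : χ₁ - χ₂ = lam • (ψ₁ - ψ₂) := by
      rw [smul_sub, sub_eq_sub_iff_sub_eq_sub.1 heq]
    exact sub_eq_zero.1 ((hχ ▸ h₁.sub h₂).eq_zero_of_eigenvalue hS0 hSsemigroup hScont hSnorm hlam)
end

section
/- Let (X,d) be a metric space with a Borel measure μ having uniformly subexponential volume growth, with 0 < V(x,1) < ∞ for every x ∈ X, and assume y ↦ V(y,1) is Borel measurable. Then for every β > 0, sup_{x∈X} ∫_X V(x,1)^{−1/2} V(y,1)^{−1/2} e^{−β d(x,y)} dμ(y) < ∞. -/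
open Filter Topology MeasureTheory Metric

/-- A Borel measure `μ` on a metric space has *uniformly subexponential volume growth* if
for every `ε > 0` there is `C(ε) > 0`, independent of `x`, with
`V(x,r) ≤ C(ε) V(x,1) e^{ε r}` for all `x` and all `r > 0`. -/
def UnifSubexpGrowth {X : Type*} [MetricSpace X] [MeasurableSpace X]
    (μ : Measure X) : Prop :=
  ∀ ε : ℝ, 0 < ε → ∃ C : ℝ, 0 < C ∧ ∀ (x : X) (r : ℝ), 0 < r →
    μ (ball x r) ≤ ENNReal.ofReal (C * Real.exp (ε * r)) * μ (ball x 1)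

/-- Under uniformly subexponential growth, `∫ e^{-γ d(x,y)} dμ(y)` is bounded by a multiple of
`V(x,1)` that does not depend on `x`. -/
theorem UnifSubexpGrowth.exists_lintegral_exp_neg_dist_le
    {X : Type*} [MetricSpace X] [MeasurableSpace X] [BorelSpace X] {μ : Measure X}
    (hμ : UnifSubexpGrowth μ) {γ : ℝ} (hγ : 0 < γ) :
    ∃ C : ℝ, 0 ≤ C ∧ ∀ x : X,
      ∫⁻ y, ENNReal.ofReal (Real.exp (-γ * dist x y)) ∂μ ≤
        ENNReal.ofReal C * μ (ball x 1) := by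
  obtain ⟨C, hC, h⟩ := hμ (γ / 2) (half_pos hγ)
  set q : ℝ := Real.exp (-(γ / 2)) with hq
  have hq1 : q < 1 := Real.exp_lt_one_iff.2 (by linarith)
  have hsum : Summable fun n : ℕ => C * Real.exp (γ / 2) * q ^ n :=
    (summable_geometric_of_lt_one (Real.exp_pos _).le hq1).mul_left _
  have hnonneg : ∀ n : ℕ, 0 ≤ C * Real.exp (γ / 2) * q ^ n := fun n => by positivity
  refine ⟨∑' n : ℕ, C * Real.exp (γ / 2) * q ^ n, tsum_nonneg hnonneg, fun x => ?_⟩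
  calc ∫⁻ y, ENNReal.ofReal (Real.exp (-γ * dist x y)) ∂μ
      ≤ ∫⁻ y, ∑' n : ℕ, (ball x (n + 1)).indicator
          (fun _ => ENNReal.ofReal (Real.exp (-γ * n))) y ∂μ := by
        refine lintegral_mono fun y => ?_
        refine le_trans ?_ (ENNReal.le_tsum ⌊dist x y⌋₊)
        have hy : y ∈ ball x ((⌊dist x y⌋₊ : ℝ) + 1) := by
          rw [mem_ball']
          exact Nat.lt_floor_add_one _
        rw [Set.indicator_of_mem hy]
        refine ENNReal.ofReal_le_ofReal (Real.exp_le_exp.2 ?_)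
        nlinarith [Nat.floor_le (dist_nonneg (x := x) (y := y))]
    _ = ∑' n : ℕ, ENNReal.ofReal (Real.exp (-γ * n)) * μ (ball x (n + 1)) := by
        rw [lintegral_tsum fun n =>
          (measurable_const.indicator measurableSet_ball).aemeasurable]
        simp_rw [lintegral_indicator_const measurableSet_ball]
    _ ≤ ∑' n : ℕ, ENNReal.ofReal (C * Real.exp (γ / 2) * q ^ n) * μ (ball x 1) := by
        refine ENNReal.tsum_le_tsum fun n => ?_
        refine (mul_le_mul_right (h x (n + 1) (by positivity)) _).trans_eq ?_
        rw [← mul_assoc, ← ENNReal.ofReal_mul (Real.exp_pos _).le]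
        congr 2
        rw [hq, ← Real.exp_nat_mul, mul_left_comm, mul_assoc, ← Real.exp_add, ← Real.exp_add]
        ring_nf
    _ = ENNReal.ofReal (∑' n : ℕ, C * Real.exp (γ / 2) * q ^ n) * μ (ball x 1) := by
        rw [ENNReal.tsum_mul_right, ENNReal.ofReal_tsum_of_nonneg hnonneg hsum]

/-- Moving the centre of a unit ball: if `V(x,1) ≤ C e^{β (1 + d(x,y))} V(y,1)`, then the kernel
`V(x,1)^{-1/2} V(y,1)^{-1/2} e^{-β d}` is bounded by a multiple of `V(x,1)^{-1} e^{-β d / 2}`. -/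
theorem rpow_neg_half_mul_exp_le {a b C β d : ℝ} (ha : 0 < a) (hb : 0 < b) (hC : 0 < C)
    (h : a ≤ C * Real.exp (β * (1 + d)) * b) :
    a ^ (-(1:ℝ)/2) * b ^ (-(1:ℝ)/2) * Real.exp (-β * d) ≤
      C ^ ((1:ℝ)/2) * Real.exp (β / 2) * a⁻¹ * Real.exp (-(β / 2) * d) := by
  have key : b ^ (-(1:ℝ)/2) ≤
      C ^ ((1:ℝ)/2) * Real.exp (β * (1 + d) * (1 / 2)) * a ^ (-(1:ℝ)/2) := by
    have h₁ := Real.rpow_le_rpow_of_nonpos ha h (by norm_num : (-(1:ℝ)/2) ≤ 0)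
    rw [Real.mul_rpow (by positivity) hb.le, neg_div, Real.rpow_neg (by positivity),
      Real.mul_rpow hC.le (Real.exp_pos _).le, ← Real.exp_mul, ← neg_div,
      inv_mul_le_iff₀ (by positivity)] at h₁
    exact h₁
  have haa : a ^ (-(1:ℝ)/2) * a ^ (-(1:ℝ)/2) = a⁻¹ := by
    rw [← Real.rpow_add ha, ← Real.rpow_neg_one]
    norm_num
  have hexp : Real.exp (β * (1 + d) * (1 / 2)) * Real.exp (-β * d) =
      Real.exp (β / 2) * Real.exp (-(β / 2) * d) := by
    rw [← Real.exp_add, ← Real.exp_add]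
    ring_nf
  calc a ^ (-(1:ℝ)/2) * b ^ (-(1:ℝ)/2) * Real.exp (-β * d)
      ≤ a ^ (-(1:ℝ)/2) * (C ^ ((1:ℝ)/2) * Real.exp (β * (1 + d) * (1 / 2)) *
          a ^ (-(1:ℝ)/2)) * Real.exp (-β * d) := by gcongr
    _ = C ^ ((1:ℝ)/2) * (a ^ (-(1:ℝ)/2) * a ^ (-(1:ℝ)/2)) *
          (Real.exp (β * (1 + d) * (1 / 2)) * Real.exp (-β * d)) := by ring
    _ = _ := by rw [haa, hexp]; ring

/-- If `μ` has uniformly subexponential volume growth and `0 < V(x,1) < ∞` for all `x`,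
then for every `β > 0`,
`sup_x ∫ V(x,1)^{-1/2} V(y,1)^{-1/2} e^{-β d(x,y)} dμ(y) < ∞`. -/
theorem sup_integral_mu_exp_lt_top
    {X : Type*} [MetricSpace X] [MeasurableSpace X] [BorelSpace X]
    (μ : Measure X)
    (hpos : ∀ x : X, μ (ball x 1) ≠ 0) (hfin : ∀ x : X, μ (ball x 1) ≠ ⊤)
    (hmeas : Measurable fun y : X => μ (ball y 1))
    (hgrowth : UnifSubexpGrowth μ) :
    ∀ β : ℝ, 0 < β → ∃ C : ℝ, ∀ x : X,
      (∫⁻ y, ENNReal.ofReal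
          ((μ (ball x 1)).toReal ^ (-(1:ℝ)/2) * (μ (ball y 1)).toReal ^ (-(1:ℝ)/2) *
            Real.exp (-β * dist x y)) ∂μ) ≤ ENNReal.ofReal C := by
  intro β hβ
  obtain ⟨C, hC, hgr⟩ := hgrowth β hβ
  obtain ⟨D, hD, hint⟩ := hgrowth.exists_lintegral_exp_neg_dist_le (half_pos hβ)
  set K : ℝ := C ^ ((1:ℝ)/2) * Real.exp (β / 2) with hK
  have hK0 : 0 ≤ K := by positivity
  have hV : ∀ x : X, 0 < (μ (ball x 1)).toReal := fun x => ENNReal.toReal_pos (hpos x) (hfin x)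
  refine ⟨K * D, fun x => ?_⟩
  have hcompare : ∀ y : X, (μ (ball x 1)).toReal ≤
      C * Real.exp (β * (1 + dist x y)) * (μ (ball y 1)).toReal := fun y => by
    have hsub : ball x 1 ⊆ ball y (1 + dist x y) := ball_subset_ball' le_rfl
    have h := (measure_mono hsub).trans (hgr y (1 + dist x y) (by positivity))
    have h' := ENNReal.toReal_mono (ENNReal.mul_ne_top ENNReal.ofReal_ne_top (hfin y)) h
    rwa [ENNReal.toReal_mul, ENNReal.toReal_ofReal (by positivity)] at h'
  have hKV : 0 ≤ K * (μ (ball x 1)).toReal⁻¹ := by positivity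
  calc _ ≤ ∫⁻ y, ENNReal.ofReal (K * (μ (ball x 1)).toReal⁻¹) *
          ENNReal.ofReal (Real.exp (-(β / 2) * dist x y)) ∂μ := by
        refine lintegral_mono fun y => ?_
        rw [← ENNReal.ofReal_mul hKV]
        exact ENNReal.ofReal_le_ofReal
          (rpow_neg_half_mul_exp_le (hV x) (hV y) hC (hcompare y))
    _ = ENNReal.ofReal (K * (μ (ball x 1)).toReal⁻¹) *
          ∫⁻ y, ENNReal.ofReal (Real.exp (-(β / 2) * dist x y)) ∂μ :=
        lintegral_const_mul' _ _ ENNReal.ofReal_ne_top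
    _ ≤ ENNReal.ofReal (K * (μ (ball x 1)).toReal⁻¹) *
          (ENNReal.ofReal D * μ (ball x 1)) := by
        gcongr
        exact hint x
    _ = ENNReal.ofReal (K * D) := by
        rw [← ENNReal.ofReal_toReal (hfin x), ENNReal.toReal_ofReal (hV x).le,
          ← ENNReal.ofReal_mul hD, ← ENNReal.ofReal_mul hKV]
        congr 1
        have := (hV x).ne'
        field_simp
end

section
/- Let (X,d) be a metric space with a Borel measure μ having uniformly subexponential volume growth, with 0 < V(x,1) < ∞ for every x ∈ X and y ↦ V(y,1) Borel measurable. Let ε > 0, C₀ > 0, and let G : X × X → [0,∞) be a measurable kernel satisfying G(x,y) ≤ C₀ V(x,1)^{−1/2} V(y,1)^{−1/2} e^{−ε d(x,y)} for all x, y ∈ X. Then there is a constant C > 0 such that for every measurable f : X → [0,∞), ∫_X ∫_X G(x,y) f(y) dμ(y) dμ(x) ≤ C ∫_X f dμ; in particular the integral operator with kernel G is bounded from L¹(μ) to L¹(μ). -/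
open Filter Topology MeasureTheory Metric

namespace UnifSubexpGrowth

variable {X : Type*} [MetricSpace X] [MeasurableSpace X] {μ : Measure X}

theorem measure_ball_lt_top (h : UnifSubexpGrowth μ) (hfin : ∀ x : X, μ (ball x 1) ≠ ⊤)
    (x : X) (r : ℝ) : μ (ball x r) < ⊤ := by
  obtain ⟨C, -, hC⟩ := h 1 one_pos
  rcases le_or_gt r 0 with hr | hr
  · simp [ball_eq_empty.2 hr]
  · exact (hC x r hr).trans_lt (ENNReal.mul_lt_top ENNReal.ofReal_lt_top (hfin x).lt_top)

theorem sigmaFinite (h : UnifSubexpGrowth μ) (hfin : ∀ x : X, μ (ball x 1) ≠ ⊤) :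
    SigmaFinite μ := by
  rcases isEmpty_or_nonempty X with hX | ⟨⟨x₀⟩⟩
  · rw [Measure.eq_zero_of_isEmpty μ]
    infer_instance
  · exact ⟨⟨{ set := fun n : ℕ => ball x₀ n
              set_mem := fun _ => trivial
              finite := fun n => h.measure_ball_lt_top hfin x₀ n
              spanning := iUnion_ball_nat x₀ }⟩⟩

/-- The integral of `x ↦ e^{-a d(x,y)}` is bounded by a uniform multiple of `V(y,1)`. -/
theorem lintegral_exp_neg_dist_le [BorelSpace X] (h : UnifSubexpGrowth μ) {a : ℝ} (ha : 0 < a) :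
    ∃ C : ℝ, 0 < C ∧ ∀ y : X,
      ∫⁻ x, ENNReal.ofReal (Real.exp (-a * dist x y)) ∂μ ≤ ENNReal.ofReal C * μ (ball y 1) := by
  obtain ⟨C, hC, hball⟩ := h (a / 2) (half_pos ha)
  set q : ℝ := Real.exp (-(a / 2)) with hq
  have hq1 : q < 1 := Real.exp_lt_one_iff.mpr (by linarith)
  have hsum : Summable fun n : ℕ => C * Real.exp (a / 2) * q ^ n :=
    (summable_geometric_of_lt_one (Real.exp_pos _).le hq1).mul_left _
  have hterm (n : ℕ) : 0 < C * Real.exp (a / 2) * q ^ n := by positivity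
  refine ⟨∑' n : ℕ, C * Real.exp (a / 2) * q ^ n,
    hsum.tsum_pos (fun n => (hterm n).le) 0 (hterm 0), fun y => ?_⟩
  calc ∫⁻ x, ENNReal.ofReal (Real.exp (-a * dist x y)) ∂μ
      ≤ ∫⁻ x, ∑' n : ℕ, (ball y (n + 1)).indicator
          (fun _ => ENNReal.ofReal (Real.exp (-a * n))) x ∂μ := by
        refine lintegral_mono fun x => ?_
        refine le_trans ?_ (ENNReal.le_tsum ⌊dist x y⌋₊)
        rw [Set.indicator_of_mem (mem_ball.2 (Nat.lt_floor_add_one _))]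
        refine ENNReal.ofReal_le_ofReal (Real.exp_le_exp.2 ?_)
        have := Nat.floor_le (dist_nonneg (x := x) (y := y))
        nlinarith
    _ = ∑' n : ℕ, ENNReal.ofReal (Real.exp (-a * n)) * μ (ball y (n + 1)) := by
        rw [lintegral_tsum fun n => (measurable_const.indicator measurableSet_ball).aemeasurable]
        simp_rw [lintegral_indicator_const measurableSet_ball]
    _ ≤ ∑' n : ℕ, ENNReal.ofReal (C * Real.exp (a / 2) * q ^ n) * μ (ball y 1) := by
        refine ENNReal.tsum_le_tsum fun n => ?_
        refine (mul_le_mul_right (hball y (n + 1) (by positivity)) _).trans_eq ?_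
        rw [← mul_assoc, ← ENNReal.ofReal_mul (Real.exp_pos _).le, mul_left_comm, mul_assoc, hq,
          ← Real.exp_nat_mul, ← Real.exp_add, ← Real.exp_add]
        ring_nf
    _ = ENNReal.ofReal (∑' n : ℕ, C * Real.exp (a / 2) * q ^ n) * μ (ball y 1) := by
        rw [ENNReal.tsum_mul_right, ENNReal.ofReal_tsum_of_nonneg (fun n => (hterm n).le) hsum]

/-- Volumes of unit balls vary at most exponentially, with an arbitrarily small rate. -/
theorem measure_ball_one_le (h : UnifSubexpGrowth μ) {a : ℝ} (ha : 0 < a) :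
    ∃ C : ℝ, 0 < C ∧ ∀ x y : X,
      μ (ball y 1) ≤ ENNReal.ofReal (C * Real.exp (a * dist x y)) * μ (ball x 1) := by
  obtain ⟨C, hC, hball⟩ := h a ha
  refine ⟨C * Real.exp a, by positivity, fun x y => ?_⟩
  have hsub : ball y 1 ⊆ ball x (1 + dist x y) :=
    ball_subset_ball' (by rw [dist_comm])
  refine ((measure_mono hsub).trans (hball x _ (by positivity))).trans_eq ?_
  rw [mul_assoc, ← Real.exp_add]
  ring_nf

/-- `V(x,1)^{-1/2}` may be replaced by `V(y,1)^{-1/2}` at the cost of half of the decay. -/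
theorem rpow_mul_rpow_mul_exp_le (h : UnifSubexpGrowth μ) (hpos : ∀ x : X, μ (ball x 1) ≠ 0)
    (hfin : ∀ x : X, μ (ball x 1) ≠ ⊤) {ε : ℝ} (hε : 0 < ε) :
    ∃ K : ℝ, 0 < K ∧ ∀ x y : X,
      (μ (ball x 1)).toReal ^ (-(1 : ℝ) / 2) * (μ (ball y 1)).toReal ^ (-(1 : ℝ) / 2) *
        Real.exp (-ε * dist x y) ≤
      K * (μ (ball y 1)).toReal⁻¹ * Real.exp (-(ε / 2) * dist x y) := by
  obtain ⟨C, hC, hcomp⟩ := h.measure_ball_one_le hε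
  refine ⟨C ^ ((1 : ℝ) / 2), by positivity, fun x y => ?_⟩
  have hw : 0 < (μ (ball y 1)).toReal := ENNReal.toReal_pos (hpos y) (hfin y)
  have hle : (μ (ball y 1)).toReal ≤
      C * Real.exp (ε * dist x y) * (μ (ball x 1)).toReal := by
    have := ENNReal.toReal_mono (ENNReal.mul_ne_top ENNReal.ofReal_ne_top (hfin x)) (hcomp x y)
    rwa [ENNReal.toReal_mul, ENNReal.toReal_ofReal (by positivity)] at this
  set v := (μ (ball x 1)).toReal
  set w := (μ (ball y 1)).toReal
  set d := dist x y
  have hM : 0 < C * Real.exp (ε * d) := by positivity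
  have hv : v ^ (-(1 : ℝ) / 2) ≤
      C ^ ((1 : ℝ) / 2) * Real.exp (ε / 2 * d) * w ^ (-(1 : ℝ) / 2) := by
    calc v ^ (-(1 : ℝ) / 2) ≤ ((C * Real.exp (ε * d))⁻¹ * w) ^ (-(1 : ℝ) / 2) :=
          Real.rpow_le_rpow_of_nonpos (by positivity) ((inv_mul_le_iff₀ hM).2 hle) (by norm_num)
      _ = _ := by
          rw [Real.mul_rpow (by positivity) hw.le, Real.inv_rpow hM.le, ← Real.rpow_neg hM.le,
            Real.mul_rpow hC.le (Real.exp_pos _).le, ← Real.exp_mul]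
          ring_nf
  have hww : w ^ (-(1 : ℝ) / 2) * w ^ (-(1 : ℝ) / 2) = w⁻¹ := by
    rw [← Real.rpow_add hw, ← Real.rpow_neg_one]
    norm_num
  have hexp : Real.exp (ε / 2 * d) * Real.exp (-ε * d) = Real.exp (-(ε / 2) * d) := by
    rw [← Real.exp_add]
    ring_nf
  calc v ^ (-(1 : ℝ) / 2) * w ^ (-(1 : ℝ) / 2) * Real.exp (-ε * d)
      ≤ C ^ ((1 : ℝ) / 2) * Real.exp (ε / 2 * d) * w ^ (-(1 : ℝ) / 2) *
          w ^ (-(1 : ℝ) / 2) * Real.exp (-ε * d) := by gcongr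
    _ = C ^ ((1 : ℝ) / 2) * w⁻¹ * Real.exp (-(ε / 2) * d) := by
        rw [← hww, ← hexp]
        ring

end UnifSubexpGrowth

/-- If `μ` has uniformly subexponential volume growth, `0 < V(x,1) < ∞` for all `x`, and a
nonnegative measurable kernel satisfies
`G(x,y) ≤ C₀ V(x,1)^{-1/2} V(y,1)^{-1/2} e^{-ε d(x,y)}`, then the integral operator with
kernel `G` is bounded from `L¹(μ)` to `L¹(μ)`:
`∫∫ G(x,y) f(y) dμ(y) dμ(x) ≤ C ∫ f dμ` for every measurable `f : X → [0,∞)`. -/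
theorem kernel_op_bounded_L1
    {X : Type*} [MetricSpace X] [MeasurableSpace X] [BorelSpace X]
    (μ : Measure X)
    (hpos : ∀ x : X, μ (ball x 1) ≠ 0) (hfin : ∀ x : X, μ (ball x 1) ≠ ⊤)
    (hmeas : Measurable fun y : X => μ (ball y 1))
    (hgrowth : UnifSubexpGrowth μ)
    (ε C₀ : ℝ) (hε : 0 < ε) (hC₀ : 0 < C₀)
    (G : X → X → ℝ)
    (hGmeas : Measurable (Function.uncurry G))
    (hGnonneg : ∀ x y : X, 0 ≤ G x y)
    (hGbound : ∀ x y : X, G x y ≤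
      C₀ * (μ (ball x 1)).toReal ^ (-(1:ℝ)/2) * (μ (ball y 1)).toReal ^ (-(1:ℝ)/2) *
        Real.exp (-ε * dist x y)) :
    ∃ C : ℝ, 0 < C ∧ ∀ f : X → ℝ, Measurable f → (∀ y, 0 ≤ f y) →
      (∫⁻ x, ∫⁻ y, ENNReal.ofReal (G x y * f y) ∂μ ∂μ)
        ≤ ENNReal.ofReal C * ∫⁻ y, ENNReal.ofReal (f y) ∂μ := by
  have := hgrowth.sigmaFinite hfin
  obtain ⟨K, hK, hKle⟩ := hgrowth.rpow_mul_rpow_mul_exp_le hpos hfin hε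
  obtain ⟨C₁, hC₁, hint⟩ := hgrowth.lintegral_exp_neg_dist_le (half_pos hε)
  refine ⟨C₀ * K * C₁, by positivity, fun f hf _ => ?_⟩
  have hcol (y : X) : ∫⁻ x, ENNReal.ofReal (G x y) ∂μ ≤ ENNReal.ofReal (C₀ * K * C₁) := by
    have hw : 0 < (μ (ball y 1)).toReal := ENNReal.toReal_pos (hpos y) (hfin y)
    calc ∫⁻ x, ENNReal.ofReal (G x y) ∂μ
        ≤ ∫⁻ x, ENNReal.ofReal (C₀ * K * (μ (ball y 1)).toReal⁻¹) *
            ENNReal.ofReal (Real.exp (-(ε / 2) * dist x y)) ∂μ := by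
          refine lintegral_mono fun x => ?_
          rw [← ENNReal.ofReal_mul (by positivity)]
          refine ENNReal.ofReal_le_ofReal ((hGbound x y).trans ?_)
          simpa only [mul_assoc] using mul_le_mul_of_nonneg_left (hKle x y) hC₀.le
      _ = ENNReal.ofReal (C₀ * K * (μ (ball y 1)).toReal⁻¹) *
            ∫⁻ x, ENNReal.ofReal (Real.exp (-(ε / 2) * dist x y)) ∂μ :=
          lintegral_const_mul' _ _ ENNReal.ofReal_ne_top
      _ ≤ ENNReal.ofReal (C₀ * K * (μ (ball y 1)).toReal⁻¹) *
            (ENNReal.ofReal C₁ * μ (ball y 1)) := by gcongr; exact hint y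
      _ = ENNReal.ofReal (C₀ * K * C₁) := by
          conv_lhs => rw [← ENNReal.ofReal_toReal (hfin y)]
          rw [ENNReal.toReal_ofReal hw.le, ← ENNReal.ofReal_mul hC₁.le,
            ← ENNReal.ofReal_mul (by positivity)]
          congr 1
          field_simp
  have hGm : Measurable fun p : X × X => ENNReal.ofReal (G p.1 p.2 * f p.2) :=
    (hGmeas.mul (hf.comp measurable_snd)).ennreal_ofReal
  rw [lintegral_lintegral_swap hGm.aemeasurable, ← lintegral_const_mul _ hf.ennreal_ofReal]
  refine lintegral_mono fun y => ?_
  simp_rw [ENNReal.ofReal_mul (hGnonneg _ y)]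
  rw [lintegral_mul_const' _ _ ENNReal.ofReal_ne_top]
  gcongr
  exact hcol y
end

section
/- Let (M, μ) be a σ-finite measure space and E a separable complex Hilbert space. Let T be a bounded linear operator on L²(μ; E) and P a bounded linear operator on L²(μ; ℝ). Suppose T has a strongly measurable integral kernel k : M × M → (E →L E), i.e. for every φ ∈ L²(μ; E) the integral ∫ k(x,y)(φ(y)) dμ(y) converges absolutely for μ-a.e. x and equals (Tφ)(x) μ-a.e., and similarly P has a measurable kernel h : M × M → [0,∞) with (Pf)(x) = ∫ h(x,y) f(y) dμ(y) μ-a.e. for every f ∈ L²(μ; ℝ). If for every φ ∈ L²(μ; E) one has ‖(Tφ)(x)‖ ≤ (P |φ|)(x) for μ-a.e. x, where |φ|(y) := ‖φ(y)‖, then the kernels satisfy the pointwise domination ‖k(x,y)‖_{op} ≤ h(x,y) for μ⊗μ-a.e. (x,y) ∈ M × M. -/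
open Filter Topology MeasureTheory

/-- A measure dominated by a finite measure on a generating semiring of sets is dominated by it. -/
theorem MeasureTheory.Measure.le_of_isSetSemiring {α : Type*} [mα : MeasurableSpace α]
    {C : Set (Set α)} (hC : IsSetSemiring C) (hgen : mα = MeasurableSpace.generateFrom C)
    (huniv : Set.univ ∈ C) {ρ ν : Measure α} [IsFiniteMeasure ν]
    (hle : ∀ s ∈ C, ρ s ≤ ν s) : ρ ≤ ν := by
  have hmeas : ∀ s ∈ C, MeasurableSet s := fun s hs => by
    rw [hgen]; exact MeasurableSpace.measurableSet_generateFrom hs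
  let m : AddContent ENNReal C :=
    { toFun := ν
      empty' := measure_empty
      sUnion' := fun I hI hd _ => by
        rw [Set.sUnion_eq_biUnion]
        exact measure_biUnion_finset hd fun s hs => hmeas s (hI hs) }
  have hm : m.IsSigmaSubadditive := fun f _ _ => measure_iUnion_le (μ := ν) f
  have hν : ν = m.measure hC hgen.le hm :=
    ext_of_generate_finite C hgen hC.isPiSystem
      (fun s hs => (m.measure_eq hC hgen hm hs).symm) (m.measure_eq hC hgen hm huniv).symm
  have hind : ρ.toOuterMeasure ≤
      inducedOuterMeasure (fun x _ => m x) hC.empty_mem addContent_empty :=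
    le_inducedOuterMeasure.2 hle
  refine Measure.le_iff.2 fun s hs => ?_
  rw [hν]
  exact (hind s).trans (le_trim (μ := m.measureCaratheodory hC hm)
    fun t ht => m.isCaratheodory_inducedOuterMeasure hC t (hgen.le t ht))

theorem isSetSemiring_measurable_rectangles (α β : Type*) [MeasurableSpace α]
    [MeasurableSpace β] :
    IsSetSemiring (Set.image2 (fun (s : Set α) (t : Set β) => s ×ˢ t)
      {s | MeasurableSet s} {t | MeasurableSet t}) where
  empty_mem := ⟨∅, .empty, ∅, .empty, by simp⟩
  inter_mem := by
    rintro _ ⟨A, hA, B, hB, rfl⟩ _ ⟨A', hA', B', hB', rfl⟩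
    exact ⟨A ∩ A', hA.inter hA', B ∩ B', hB.inter hB', Set.prod_inter_prod.symm⟩
  sdiff_eq_sUnion' := by
    classical
    rintro _ ⟨A, hA, B, hB, rfl⟩ _ ⟨A', hA', B', hB', rfl⟩
    refine ⟨{(A \ A') ×ˢ B, (A ∩ A') ×ˢ (B \ B')}, ?_, ?_, ?_⟩
    · simp only [Finset.coe_insert, Finset.coe_singleton, Set.insert_subset_iff,
        Set.singleton_subset_iff]
      exact ⟨⟨_, hA.diff hA', _, hB, rfl⟩, ⟨_, hA.inter hA', _, hB.diff hB', rfl⟩⟩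
    · rw [Finset.coe_pair]
      refine Set.pairwise_pair_of_symm.2 fun _ => ?_
      exact Set.disjoint_prod.2 (.inl (Set.disjoint_sdiff_inter ..))
    · ext ⟨x, y⟩
      simp
      tauto

/-- If, for each set `B` of finite measure, almost every section of `g` is integrable on `B` with
nonnegative integral, then `g` is nonnegative almost everywhere on the product. The exceptional
null set of sections may depend on `B`. -/
theorem ae_nonneg_prod_of_forall_ae_setIntegral_nonneg {α β : Type*} [MeasurableSpace α]
    [MeasurableSpace β] {μ : Measure α} {ν : Measure β} [SigmaFinite μ] [SigmaFinite ν]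
    {g : α × β → ℝ} (hg : Measurable g)
    (hint : ∀ B : Set β, MeasurableSet B → ν B < ⊤ → ∀ᵐ x ∂μ,
      IntegrableOn (fun y => g (x, y)) B ν ∧ 0 ≤ ∫ y in B, g (x, y) ∂ν) :
    ∀ᵐ p ∂(μ.prod ν), 0 ≤ g p := by
  have hpos : Measurable fun p => ENNReal.ofReal (g p) := hg.ennreal_ofReal
  have hneg : Measurable fun p => ENNReal.ofReal (-g p) := hg.neg.ennreal_ofReal
  have hle : ∀ B : Set β, MeasurableSet B → ν B < ⊤ → ∀ᵐ x ∂μ,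
      ∫⁻ y in B, ENNReal.ofReal (-g (x, y)) ∂ν ≤ ∫⁻ y in B, ENNReal.ofReal (g (x, y)) ∂ν := by
    intro B hB hνB
    filter_upwards [hint B hB hνB] with x ⟨hx, h0⟩
    rw [integral_eq_lintegral_pos_part_sub_lintegral_neg_part hx, sub_nonneg] at h0
    exact (ENNReal.toReal_le_toReal hx.neg.lintegral_lt_top.ne hx.lintegral_lt_top.ne).1 h0
  let S := spanningSets μ
  let R := spanningSets ν
  let A : ℕ → ℕ → Set α := fun n m =>
    S n ∩ {x | ∫⁻ y in R n, ENNReal.ofReal (g (x, y)) ∂ν ≤ m}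
  have hA : ∀ n m, MeasurableSet (A n m) := fun n m =>
    (measurableSet_spanningSets μ n).inter
      (measurableSet_le hpos.lintegral_prod_right' measurable_const)
  have hR : ∀ n, MeasurableSet (R n) := measurableSet_spanningSets ν
  have hrect : ∀ n m, ∀ᵐ p ∂(μ.prod ν).restrict (A n m ×ˢ R n), 0 ≤ g p := by
    intro n m
    set σ := (μ.prod ν).restrict (A n m ×ˢ R n) with hσ
    have hset : ∀ f : α × β → ENNReal, Measurable f → ∀ s t, MeasurableSet s → MeasurableSet t →
        ∫⁻ p in s ×ˢ t, f p ∂σ = ∫⁻ x in s ∩ A n m, ∫⁻ y in t ∩ R n, f (x, y) ∂ν ∂μ := by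
      intro f hf s t hs ht
      rw [hσ, Measure.restrict_restrict (hs.prod ht), Set.prod_inter_prod,
        setLIntegral_prod _ hf.aemeasurable]
    have hfin : ∫⁻ p, ENNReal.ofReal (g p) ∂σ ≠ ⊤ := by
      rw [← setLIntegral_univ, ← Set.univ_prod_univ, hset _ hpos _ _ .univ .univ,
        Set.univ_inter, Set.univ_inter]
      refine ((setLIntegral_mono measurable_const fun x hx => hx.2).trans_lt ?_).ne
      rw [setLIntegral_const]
      exact ENNReal.mul_lt_top (ENNReal.natCast_lt_top m)
        ((measure_mono Set.inter_subset_left).trans_lt (measure_spanningSets_lt_top μ n))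
    have : IsFiniteMeasure (σ.withDensity fun p => ENNReal.ofReal (g p)) :=
      isFiniteMeasure_withDensity hfin
    have hdens : (σ.withDensity fun p => ENNReal.ofReal (-g p)) ≤
        σ.withDensity fun p => ENNReal.ofReal (g p) := by
      refine Measure.le_of_isSetSemiring (isSetSemiring_measurable_rectangles α β)
        generateFrom_prod.symm ⟨_, .univ, _, .univ, Set.univ_prod_univ⟩ ?_
      rintro _ ⟨s, hs, t, ht, rfl⟩
      dsimp only
      rw [withDensity_apply _ (hs.prod ht), withDensity_apply _ (hs.prod ht),
        hset _ hneg s t hs ht, hset _ hpos s t hs ht]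
      exact lintegral_mono_ae <| ae_restrict_of_ae <| hle _ (ht.inter (hR n)) <|
        (measure_mono Set.inter_subset_right).trans_lt (measure_spanningSets_lt_top ν n)
    have hae : (fun p => ENNReal.ofReal (-g p)) ≤ᵐ[σ] fun p => ENNReal.ofReal (g p) := by
      refine ae_le_of_forall_setLIntegral_le_of_sigmaFinite hneg fun s hs _ => ?_
      rw [← withDensity_apply _ hs, ← withDensity_apply _ hs]
      exact hdens s
    filter_upwards [hae] with p hp
    by_contra! hlt
    rw [ENNReal.ofReal_of_nonpos hlt.le, nonpos_iff_eq_zero, ENNReal.ofReal_eq_zero] at hp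
    linarith
  have hall : ∀ᵐ p ∂(μ.prod ν), ∀ n m, p ∈ A n m ×ˢ R n → 0 ≤ g p :=
    ae_all_iff.2 fun n => ae_all_iff.2 fun m =>
      (ae_restrict_iff' ((hA n m).prod (hR n))).1 (hrect n m)
  have hfinx : ∀ᵐ x ∂μ, ∀ n, ∫⁻ y in R n, ENNReal.ofReal (g (x, y)) ∂ν < ⊤ :=
    ae_all_iff.2 fun n => (hint (R n) (hR n) (measure_spanningSets_lt_top ν n)).mono
      fun x hx => hx.1.lintegral_lt_top
  filter_upwards [hall, Measure.quasiMeasurePreserving_fst.ae hfinx] with p hp hpf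
  let n := max (spanningSetsIndex μ p.1) (spanningSetsIndex ν p.2)
  obtain ⟨m, hm⟩ := ENNReal.exists_nat_gt (hpf n).ne
  exact hp n m ⟨⟨monotone_spanningSets μ (le_max_left _ _) (mem_spanningSetsIndex μ p.1), hm.le⟩,
    monotone_spanningSets ν (le_max_right _ _) (mem_spanningSetsIndex ν p.2)⟩

theorem norm_le_of_forall_denseRange_re_inner_le {E : Type*} [NormedAddCommGroup E]
    [InnerProductSpace ℂ E] {ι : Type*} {d : ι → E} (hd : DenseRange d) {v : E} {c : ℝ}
    (hv : ∀ i, (inner ℂ (d i) v).re ≤ c * ‖d i‖) (hc : 0 ≤ c) : ‖v‖ ≤ c := by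
  have hall : ∀ w : E, (inner ℂ w v).re ≤ c * ‖w‖ := fun w =>
    hd.induction_on w (isClosed_le (by fun_prop) (by fun_prop)) hv
  have hvv : ‖v‖ * ‖v‖ ≤ c * ‖v‖ := by
    simpa [inner_self_eq_norm_sq_to_K, ← Complex.ofReal_pow, pow_two, ← Complex.ofReal_mul] using hall v
  by_contra! hlt
  nlinarith

/-- If a bounded operator `T` on `L²(μ; E)` with strongly measurable integral kernel `k`
is pointwise dominated by a bounded operator `P` on `L²(μ; ℝ)` with nonnegative measurable
integral kernel `h`, i.e. `‖(Tφ)(x)‖ ≤ (P|φ|)(x)` a.e. for every `φ`, then the kernels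
satisfy `‖k(x,y)‖ ≤ h(x,y)` for `μ ⊗ μ`-a.e. `(x,y)`. -/
theorem kernel_domination_of_operator_domination
    {M : Type*} [MeasurableSpace M] (μ : Measure M) [SigmaFinite μ]
    {E : Type*} [NormedAddCommGroup E] [InnerProductSpace ℂ E] [CompleteSpace E]
    [SecondCountableTopology E]
    (T : Lp E 2 μ →L[ℂ] Lp E 2 μ) (P : Lp ℝ 2 μ →L[ℝ] Lp ℝ 2 μ)
    (k : M → M → E →L[ℂ] E) (h : M → M → ℝ)
    (hk_meas : StronglyMeasurable (Function.uncurry k))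
    (hh_meas : Measurable (Function.uncurry h))
    (hh_nonneg : ∀ x y : M, 0 ≤ h x y)
    (hk_ker : ∀ φ : Lp E 2 μ, ∀ᵐ x ∂μ,
      Integrable (fun y => (k x y) (φ y)) μ ∧ (T φ) x = ∫ y, (k x y) (φ y) ∂μ)
    (hh_ker : ∀ f : Lp ℝ 2 μ, ∀ᵐ x ∂μ,
      Integrable (fun y => h x y * f y) μ ∧ (P f) x = ∫ y, h x y * f y ∂μ)
    (hdom : ∀ (φ : Lp E 2 μ) (f : Lp ℝ 2 μ), (∀ᵐ y ∂μ, f y = ‖φ y‖) →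
      ∀ᵐ x ∂μ, ‖(T φ) x‖ ≤ (P f) x) :
    ∀ᵐ p ∂(μ.prod μ), ‖k p.1 p.2‖ ≤ h p.1 p.2 := by
  have hweak : ∀ e w : E, ∀ᵐ p ∂(μ.prod μ),
      0 ≤ h p.1 p.2 * ‖e‖ * ‖w‖ - (inner ℂ w (k p.1 p.2 e)).re := by
    intro e w
    have hke : StronglyMeasurable fun p : M × M => k p.1 p.2 e :=
      (ContinuousLinearMap.apply ℂ E e).continuous.comp_stronglyMeasurable hk_meas
    refine ae_nonneg_prod_of_forall_ae_setIntegral_nonneg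
      (g := fun p => h p.1 p.2 * ‖e‖ * ‖w‖ - (inner ℂ w (k p.1 p.2 e)).re)
      (((hh_meas.mul_const _).mul_const _).sub
        (Complex.measurable_re.comp (stronglyMeasurable_const.inner hke).measurable)) ?_
    intro B hB hμB
    let φ : Lp E 2 μ := indicatorConstLp 2 hB hμB.ne e
    let f : Lp ℝ 2 μ := indicatorConstLp 2 hB hμB.ne ‖e‖
    have hφ : φ =ᵐ[μ] B.indicator fun _ => e := indicatorConstLp_coeFn
    have hf : f =ᵐ[μ] B.indicator fun _ => ‖e‖ := indicatorConstLp_coeFn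
    have hfφ : ∀ᵐ y ∂μ, f y = ‖φ y‖ := by
      filter_upwards [hφ, hf] with y h1 h2
      rw [h1, h2, norm_indicator_eq_indicator_norm]
    filter_upwards [hk_ker φ, hh_ker f, hdom φ f hfφ] with x ⟨hki, hkT⟩ ⟨hhi, hhP⟩ hx
    have hkx : (fun y => k x y (φ y)) =ᵐ[μ] B.indicator fun y => k x y e := by
      filter_upwards [hφ] with y hy
      rw [hy]; by_cases hyB : y ∈ B <;> simp [hyB]
    have hhx : (fun y => h x y * f y) =ᵐ[μ] B.indicator fun y => h x y * ‖e‖ := by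
      filter_upwards [hf] with y hy
      rw [hy]; by_cases hyB : y ∈ B <;> simp [hyB]
    have hkB : IntegrableOn (fun y => k x y e) B μ :=
      (integrable_indicator_iff hB).1 (hki.congr hkx)
    have hhB : IntegrableOn (fun y => h x y * ‖e‖) B μ :=
      (integrable_indicator_iff hB).1 (hhi.congr hhx)
    rw [hkT, hhP, integral_congr_ae hkx, integral_congr_ae hhx, integral_indicator hB,
      integral_indicator hB] at hx
    have hin : IntegrableOn (fun y => (inner ℂ w (k x y e)).re) B μ :=
      (hkB.const_inner (𝕜 := ℂ) w).re
    refine ⟨(hhB.mul_const _).sub hin, ?_⟩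
    have hre : ∫ y in B, (inner ℂ w (k x y e)).re ∂μ = (inner ℂ w (∫ y in B, k x y e ∂μ)).re := by
      rw [← integral_inner hkB]
      exact integral_re (hkB.const_inner (𝕜 := ℂ) w)
    rw [integral_sub (hhB.mul_const _) hin, integral_mul_const, hre, sub_nonneg]
    calc (inner ℂ w (∫ y in B, k x y e ∂μ)).re ≤ ‖w‖ * ‖∫ y in B, k x y e ∂μ‖ :=
          re_inner_le_norm (𝕜 := ℂ) _ _
      _ ≤ (∫ y in B, h x y * ‖e‖ ∂μ) * ‖w‖ := by rw [mul_comm]; gcongr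
  have hd := TopologicalSpace.denseRange_denseSeq E
  filter_upwards [ae_all_iff.2 fun i => ae_all_iff.2 fun j =>
    hweak (TopologicalSpace.denseSeq E i) (TopologicalSpace.denseSeq E j)] with p hp
  have h0 := hh_nonneg p.1 p.2
  refine ContinuousLinearMap.opNorm_le_bound _ h0 fun e => ?_
  refine hd.induction_on e (isClosed_le (by fun_prop) (by fun_prop)) fun i => ?_
  exact norm_le_of_forall_denseRange_re_inner_le hd (fun j => sub_nonneg.1 (hp i j)) (by positivity)
end

section
/- Let m ≥ 1 be an integer and f : (0,∞) → (0,∞) a continuously differentiable, nondecreasing, positive function. Then for every T > 0, the quotient ( ∫_T^{4T} (m/2)(f'(t)/f(t)) f(t)^m dt + (2/T) ∫_T^{4T} f(t)^m dt ) / ( ∫_{2T}^{3T} f(t)^m dt ) is at most 7 f(4T)^m / (T f(2T)^m). Moreover, if lim_{t→∞} f(2t)^m / (t f(t)^m) = 0, then this quotient tends to 0 as T → ∞. -/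
open Filter Topology intervalIntegral

/-- The logarithmic derivative of `f`, weighted by `fᵐ`, integrates to the increment of `fᵐ / 2`. -/
theorem integral_half_logDeriv_mul_pow {m : ℕ} (hm : 1 ≤ m) {f f' : ℝ → ℝ} {a b : ℝ} (hab : a ≤ b)
    (hf : ∀ t ∈ Set.Icc a b, f t ≠ 0) (hd : ∀ t ∈ Set.Icc a b, HasDerivAt f (f' t) t)
    (hc : ContinuousOn f' (Set.Icc a b)) :
    ∫ t in a..b, ((m : ℝ) / 2) * (f' t / f t) * f t ^ m = (f b ^ m - f a ^ m) / 2 := by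
  have hfc : ContinuousOn f (Set.Icc a b) := fun t ht => (hd t ht).continuousAt.continuousWithinAt
  rw [← Set.uIcc_of_le hab] at hf hd hc hfc
  rw [integral_eq_sub_of_hasDerivAt (f := fun t => f t ^ m / 2)]
  · ring
  · intro t ht
    refine (((hd t ht).pow m).div_const 2).congr_deriv ?_
    obtain ⟨k, rfl⟩ := Nat.exists_eq_add_of_le' hm
    have := hf t ht
    rw [Nat.add_sub_cancel]
    field_simp
    ring
  · exact ((continuousOn_const.mul (hc.div hfc hf)).mul (hfc.pow m)).intervalIntegrable

theorem MonotoneOn.integral_le_sub_mul {g : ℝ → ℝ} {a b : ℝ} (hab : a ≤ b)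
    (hg : MonotoneOn g (Set.Icc a b)) : ∫ t in a..b, g t ≤ (b - a) * g b := by
  have hi : IntervalIntegrable g MeasureTheory.volume a b :=
    MonotoneOn.intervalIntegrable (by rwa [Set.uIcc_of_le hab])
  simpa using integral_mono_on hab hi (intervalIntegrable_const (c := g b))
    fun t ht => hg ht (Set.right_mem_Icc.2 hab) ht.2

theorem MonotoneOn.sub_mul_le_integral {g : ℝ → ℝ} {a b : ℝ} (hab : a ≤ b)
    (hg : MonotoneOn g (Set.Icc a b)) : (b - a) * g a ≤ ∫ t in a..b, g t := by
  have hi : IntervalIntegrable g MeasureTheory.volume a b :=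
    MonotoneOn.intervalIntegrable (by rwa [Set.uIcc_of_le hab])
  simpa using integral_mono_on hab (intervalIntegrable_const (c := g a)) hi
    fun t ht => hg (Set.left_mem_Icc.2 hab) ht ht.1

/-- For a positive, nondecreasing, continuously differentiable warping profile `f` and
`m ≥ 1`, the `L¹`-Rayleigh-type quotient of the test spinors supported in `N × [T,4T]`,
`(∫_T^{4T} (m/2)(f'/f) fᵐ + (2/T)∫_T^{4T} fᵐ) / ∫_{2T}^{3T} fᵐ`, is at most
`7 f(4T)ᵐ/(T f(2T)ᵐ)`; hence it tends to `0` as `T → ∞` provided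
`f(2t)ᵐ/(t f(t)ᵐ) → 0`. -/
theorem warped_product_test_quotient_bound
    (m : ℕ) (hm : 1 ≤ m)
    (f f' : ℝ → ℝ)
    (hf_pos : ∀ t : ℝ, 0 < t → 0 < f t)
    (hf_mono : MonotoneOn f (Set.Ioi 0))
    (hf_deriv : ∀ t ∈ Set.Ioi (0:ℝ), HasDerivAt f (f' t) t)
    (hf'_cont : ContinuousOn f' (Set.Ioi 0)) :
    (∀ T : ℝ, 0 < T →
      ((∫ t in T..(4*T), ((m:ℝ)/2) * (f' t / f t) * (f t) ^ m) +
          (2/T) * ∫ t in T..(4*T), (f t) ^ m) / (∫ t in (2*T)..(3*T), (f t) ^ m)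
        ≤ 7 * (f (4*T)) ^ m / (T * (f (2*T)) ^ m)) ∧
    (Tendsto (fun t : ℝ => (f (2*t)) ^ m / (t * (f t) ^ m)) atTop (𝓝 0) →
      Tendsto (fun T : ℝ =>
          ((∫ t in T..(4*T), ((m:ℝ)/2) * (f' t / f t) * (f t) ^ m) +
            (2/T) * ∫ t in T..(4*T), (f t) ^ m) / (∫ t in (2*T)..(3*T), (f t) ^ m))
        atTop (𝓝 0)) := by
  have hpow : MonotoneOn (fun t => f t ^ m) (Set.Ioi 0) := fun x hx y hy hxy =>
    pow_le_pow_left₀ (hf_pos x hx).le (hf_mono hx hy hxy) m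
  have hsub : ∀ {a : ℝ} (b : ℝ), 0 < a → Set.Icc a b ⊆ Set.Ioi 0 := fun _ ha _ ht =>
    ha.trans_le ht.1
  have hlog : ∀ T : ℝ, 0 < T → ∫ t in T..(4*T), ((m:ℝ)/2) * (f' t / f t) * (f t) ^ m
      = (f (4*T) ^ m - f T ^ m) / 2 := fun T hT =>
    integral_half_logDeriv_mul_pow hm (by linarith) (fun t ht => (hf_pos t (hsub _ hT ht)).ne')
      (fun t ht => hf_deriv t (hsub _ hT ht)) (hf'_cont.mono (hsub _ hT))
  have hlower : ∀ {a b : ℝ}, 0 < a → a ≤ b → (b - a) * f a ^ m ≤ ∫ t in a..b, f t ^ m :=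
    fun ha hab => (hpow.mono (hsub _ ha)).sub_mul_le_integral hab
  have hbound : ∀ T : ℝ, 0 < T →
      ((∫ t in T..(4*T), ((m:ℝ)/2) * (f' t / f t) * (f t) ^ m) +
          (2/T) * ∫ t in T..(4*T), (f t) ^ m) / (∫ t in (2*T)..(3*T), (f t) ^ m)
        ≤ 7 * (f (4*T)) ^ m / (T * (f (2*T)) ^ m) := by
    intro T hT
    have h1 : 0 < f T ^ m := pow_pos (hf_pos _ hT) m
    have h2 : 0 < f (2*T) ^ m := pow_pos (hf_pos _ (by linarith)) m
    have h4 : 0 < f (4*T) ^ m := pow_pos (hf_pos _ (by linarith)) m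
    have hden : T * f (2*T) ^ m ≤ ∫ t in (2*T)..(3*T), f t ^ m := by
      have := hlower (a := 2*T) (b := 3*T) (by linarith) (by linarith)
      linarith
    have hupper : (2/T) * ∫ t in T..(4*T), f t ^ m ≤ 6 * f (4*T) ^ m := by
      calc (2/T) * ∫ t in T..(4*T), f t ^ m ≤ (2/T) * ((4*T - T) * f (4*T) ^ m) := by
            gcongr
            exact (hpow.mono (hsub _ hT)).integral_le_sub_mul (by linarith)
        _ = 6 * f (4*T) ^ m := by
            field_simp
            ring
    rw [hlog T hT]
    exact div_le_div₀ (by positivity) (by linarith) (by positivity) hden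
  refine ⟨hbound, fun hlim => ?_⟩
  have hlim' := (hlim.comp (tendsto_id.const_mul_atTop (two_pos (α := ℝ)))).const_mul 14
  rw [mul_zero] at hlim'
  refine tendsto_of_tendsto_of_tendsto_of_le_of_le' tendsto_const_nhds hlim' ?_ ?_
  · filter_upwards [eventually_gt_atTop 0] with T hT
    have h14 : f T ^ m ≤ f (4*T) ^ m :=
      hpow hT (show (0:ℝ) < 4*T by linarith) (by linarith)
    have hnonneg : ∀ {a b : ℝ}, 0 < a → a ≤ b → 0 ≤ ∫ t in a..b, f t ^ m := fun ha hab =>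
      (mul_nonneg (sub_nonneg.2 hab) (pow_pos (hf_pos _ ha) m).le).trans (hlower ha hab)
    rw [hlog T hT]
    exact div_nonneg (add_nonneg (by linarith)
      (mul_nonneg (by positivity) (hnonneg hT (by linarith))))
      (hnonneg (by linarith) (by linarith))
  · filter_upwards [eventually_gt_atTop 0] with T hT
    refine (hbound T hT).trans_eq ?_
    have h2 : f (2*T) ≠ 0 := (hf_pos _ (by linarith)).ne'
    simp only [Function.comp_apply, id_eq]
    rw [show 2 * (2*T) = 4*T by ring]
    field_simp
    ring
end
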